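/- For every s ≥ 1 and every m ∈ {2,3,4}: max K(b^s,1,1) + max K(c^s,m) > min K(b^s,1,2) + min K(c^s,m). Consequently, the Minkowski sum (K(b^s,1,1) ∪ K(b^s,1,2)) + K(c^s,m) is exactly the closed interval [ [0; b^s, 1, 1, \overline{3,1}] + [0; c^s, m, \overline{1,3}] , [0; b^s, 1, 2, \overline{1,3}] + [0; c^s, m, θ^m] ], where θ^m = 4, \overline{1,3} if m ∈ {3,4} and θ^m = \overline{3,1} if m = 2. -/

import Mathlib

open Filter Set
open scoped Pointwise

noncomputable section

/-- The `n`-th convergent of the continued fraction `[0; a 0, a 1, a 2, …]`. -/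
def cfConv : ℕ → (ℕ → ℕ) → ℝ
  | 0, _ => 0
  | n + 1, a => 1 / (a 0 + cfConv n fun i => a (i + 1))

/-- The value `[0; a 0, a 1, a 2, …]` of the infinite continued fraction with
partial quotients `a 0, a 1, …` (the limit of its convergents). -/
def cfVal (a : ℕ → ℕ) : ℝ := limUnder atTop fun n => cfConv n a

/-- The sequence of partial quotients obtained by concatenating the finite word `b`
with the sequence `θ`. -/
def app (b : List ℕ) (θ : ℕ → ℕ) : ℕ → ℕ := fun n =>
  if h : n < b.length then b.get ⟨n, h⟩ else θ (n - b.length)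

/-- The forbidden pairs of consecutive partial quotients. -/
def badPairs : Set (ℕ × ℕ) := {(1, 4), (2, 4)}

/-- The set `D` of sequences with entries in `{1,2,3,4}` avoiding the pairs
`(1,4)` and `(2,4)`. -/
def Dset : Set (ℕ → ℕ) :=
  {θ | (∀ n, θ n ∈ ({1, 2, 3, 4} : Set ℕ)) ∧ ∀ n, (θ n, θ (n + 1)) ∉ badPairs}

/-- The Cantor set `K(b) = {[0; b, θ] : θ ∈ D, (b_s, θ_1) ∉ {(1,4),(2,4)}}`. -/
def Kb (b : List ℕ) : Set ℝ :=
  {x | ∃ θ ∈ Dset, (∀ d, b.getLast? = some d → (d, θ 0) ∉ badPairs) ∧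
    x = cfVal (app b θ)}

/-- The set `K̃(b) ⊆ K(b)` of values `[0; b, θ]` with moreover `(θ_1, θ_2) ≠ (1,3)`. -/
def Ktil (b : List ℕ) : Set ℝ :=
  {x | ∃ θ ∈ Dset, (∀ d, b.getLast? = some d → (d, θ 0) ∉ badPairs) ∧
    (θ 0, θ 1) ≠ (1, 3) ∧ x = cfVal (app b θ)}

/-- The word `b^s = (1,4)_s`. -/
def bW (s : ℕ) : List ℕ := (List.replicate s [1, 4]).flatten

/-- The word `c^s = (1,4)_{s-1}, 1, 3`. -/
def cW (s : ℕ) : List ℕ := bW (s - 1) ++ [1, 3]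

/-- The periodic sequence `\overline{1,3}`. -/
def per13 : ℕ → ℕ := fun n => if n % 2 = 0 then 1 else 3

/-- The periodic sequence `\overline{3,1}`. -/
def per31 : ℕ → ℕ := fun n => if n % 2 = 0 then 3 else 1

open scoped Topology

/-- The sequences all of whose entries lie between `1` and `4`. -/
def DigitSeq : Set (ℕ → ℕ) := {θ | ∀ n, 1 ≤ θ n ∧ θ n ≤ 4}

lemma Dset_subset_DigitSeq : Dset ⊆ DigitSeq := by
  intro θ hθ n
  have := hθ.1 n
  simp only [mem_insert_iff, mem_singleton_iff] at this
  omega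

lemma DigitSeq.tail {θ : ℕ → ℕ} (h : θ ∈ DigitSeq) : (fun i => θ (i + 1)) ∈ DigitSeq :=
  fun n => h (n + 1)

lemma DigitSeq.one_le {θ : ℕ → ℕ} (h : θ ∈ DigitSeq) : (1 : ℝ) ≤ θ 0 := by
  exact_mod_cast (h 0).1

lemma DigitSeq.le_four {θ : ℕ → ℕ} (h : θ ∈ DigitSeq) : (θ 0 : ℝ) ≤ 4 := by
  exact_mod_cast (h 0).2

lemma one_div_add_mem_Icc {e x a b : ℝ} (he : 1 ≤ e) (ha : 0 ≤ a) (hx : x ∈ Icc a b) :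
    1 / (e + x) ∈ Icc (1 / (e + b)) (1 / (e + a)) :=
  ⟨one_div_le_one_div_of_le (by linarith [hx.1]) (by linarith [hx.2]),
    one_div_le_one_div_of_le (by linarith) (by linarith [hx.1])⟩

lemma one_div_add_mem_unitInterval {e x : ℝ} (he : 1 ≤ e) (hx : x ∈ Icc (0 : ℝ) 1) :
    1 / (e + x) ∈ Icc (0 : ℝ) 1 := by
  have h : 1 ≤ e + x := by linarith [hx.1]
  exact ⟨by positivity, by rw [div_le_one (by linarith)]; exact h⟩

lemma cfConv_mem_Icc (n : ℕ) {θ : ℕ → ℕ} (h : θ ∈ DigitSeq) : cfConv n θ ∈ Icc (0 : ℝ) 1 := by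
  induction n generalizing θ with
  | zero => simp [cfConv]
  | succ n ih => exact one_div_add_mem_unitInterval (DigitSeq.one_le h) (ih (DigitSeq.tail h))

lemma cfConv_succ_ge (n : ℕ) {θ : ℕ → ℕ} (h : θ ∈ DigitSeq) : 1 / 5 ≤ cfConv (n + 1) θ := by
  have h1 := cfConv_mem_Icc n (DigitSeq.tail h)
  exact one_div_le_one_div_of_le (by linarith [DigitSeq.one_le h, h1.1])
    (by linarith [DigitSeq.le_four h, h1.2])

lemma abs_one_div_add_sub_le {a x y : ℝ} (ha : 1 ≤ a) (hx : 1 / 5 ≤ x) (hy : 1 / 5 ≤ y) :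
    |1 / (a + x) - 1 / (a + y)| ≤ 25 / 36 * |x - y| := by
  have h1 : 6 / 5 ≤ a + x := by linarith
  have h2 : 6 / 5 ≤ a + y := by linarith
  have h3 : 1 / (a + x) - 1 / (a + y) = (y - x) / ((a + x) * (a + y)) := by
    field_simp
    ring
  have h4 : 36 / 25 ≤ (a + x) * (a + y) := by nlinarith
  rw [h3, abs_div, abs_sub_comm y x, abs_of_pos (by linarith : 0 < (a + x) * (a + y)),
    div_le_iff₀ (by linarith)]
  nlinarith [abs_nonneg (x - y)]

lemma abs_cfConv_sub_le (n m : ℕ) {θ : ℕ → ℕ} (h : θ ∈ DigitSeq) :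
    |cfConv (n + 1) θ - cfConv (n + 1 + m) θ| ≤ (25 / 36) ^ n := by
  induction n generalizing θ with
  | zero =>
    have h1 := cfConv_mem_Icc (0 + 1) h
    have h2 := cfConv_mem_Icc (0 + 1 + m) h
    rw [pow_zero, abs_le]
    constructor <;> linarith [h1.1, h1.2, h2.1, h2.2]
  | succ n ih =>
    rw [show n + 1 + 1 + m = (n + 1 + m) + 1 by ring]
    have h2 : 1 / 5 ≤ cfConv (n + 1 + m) (fun i => θ (i + 1)) := by
      rw [show n + 1 + m = (n + m) + 1 by ring]
      exact cfConv_succ_ge _ (DigitSeq.tail h)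
    refine (abs_one_div_add_sub_le (DigitSeq.one_le h) (cfConv_succ_ge n (DigitSeq.tail h))
      h2).trans ?_
    rw [pow_succ']
    exact mul_le_mul_of_nonneg_left (ih (DigitSeq.tail h)) (by norm_num)

lemma tendsto_cfConv {θ : ℕ → ℕ} (h : θ ∈ DigitSeq) :
    Tendsto (fun n => cfConv n θ) atTop (𝓝 (cfVal θ)) := by
  have hc : CauchySeq fun n => cfConv (n + 1) θ := by
    refine cauchySeq_of_le_geometric (25 / 36) 1 (by norm_num) fun n => ?_
    rw [one_mul, Real.dist_eq]
    exact abs_cfConv_sub_le n 1 h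
  obtain ⟨x, hx⟩ := cauchySeq_tendsto_of_complete hc
  exact tendsto_nhds_limUnder ⟨x, (tendsto_add_atTop_iff_nat 1).1 hx⟩

lemma abs_cfConv_sub_cfVal_le (n : ℕ) {θ : ℕ → ℕ} (h : θ ∈ DigitSeq) :
    |cfConv (n + 1) θ - cfVal θ| ≤ (25 / 36) ^ n := by
  have ht : Tendsto (fun m => |cfConv (n + 1) θ - cfConv (n + 1 + m) θ|) atTop
      (𝓝 |cfConv (n + 1) θ - cfVal θ|) :=
    (tendsto_const_nhds.sub ((tendsto_cfConv h).comp
      (tendsto_atTop_mono (fun m => Nat.le_add_left m (n + 1)) tendsto_id))).abs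
  exact le_of_tendsto' ht fun m => abs_cfConv_sub_le n m h

lemma cfVal_mem_Icc {θ : ℕ → ℕ} (h : θ ∈ DigitSeq) : cfVal θ ∈ Icc (0 : ℝ) 1 :=
  isClosed_Icc.mem_of_tendsto (tendsto_cfConv h) (Eventually.of_forall fun n => cfConv_mem_Icc n h)

lemma cfVal_eq {θ : ℕ → ℕ} (h : θ ∈ DigitSeq) :
    cfVal θ = 1 / (θ 0 + cfVal fun i => θ (i + 1)) := by
  refine tendsto_nhds_unique ((tendsto_add_atTop_iff_nat 1).2 (tendsto_cfConv h)) ?_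
  refine tendsto_const_nhds.div (tendsto_const_nhds.add (tendsto_cfConv (DigitSeq.tail h))) ?_
  linarith [DigitSeq.one_le h, (cfVal_mem_Icc (DigitSeq.tail h)).1]

lemma continuousOn_cfConv (n : ℕ) : ContinuousOn (cfConv n) DigitSeq := by
  induction n with
  | zero => exact continuousOn_const
  | succ n ih =>
    refine continuousOn_const.div (ContinuousOn.add ?_ ?_) fun θ h => ?_
    · exact (continuous_of_discreteTopology.comp (continuous_apply 0)).continuousOn
    · exact ih.comp (continuous_pi fun i => continuous_apply (i + 1)).continuousOn
        fun θ h => DigitSeq.tail h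
    · linarith [DigitSeq.one_le h, (cfConv_mem_Icc n (DigitSeq.tail h)).1]

lemma continuousOn_cfVal : ContinuousOn cfVal DigitSeq := by
  have hu : TendstoUniformlyOn (fun n => cfConv (n + 1)) cfVal atTop DigitSeq := by
    rw [Metric.tendstoUniformlyOn_iff]
    intro ε hε
    have ht : Tendsto (fun n : ℕ => (25 / 36 : ℝ) ^ n) atTop (𝓝 0) :=
      tendsto_pow_atTop_nhds_zero_of_lt_one (by norm_num) (by norm_num)
    filter_upwards [ht.eventually (gt_mem_nhds hε)] with n hn θ h
    rw [dist_comm, Real.dist_eq]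
    exact (abs_cfConv_sub_cfVal_le n h).trans_lt hn
  exact hu.continuousOn (Eventually.of_forall fun n => continuousOn_cfConv (n + 1)).frequently

/-- The values `[0; θ]` with `θ ∈ D` and `θ_1 ∈ S`. -/
def tailSet (S : Set ℕ) : Set ℝ := cfVal '' {θ | θ ∈ Dset ∧ θ 0 ∈ S}

lemma isCompact_tailSet (S : Set ℕ) : IsCompact (tailSet S) := by
  refine IsCompact.image_of_continuousOn ?_
    (continuousOn_cfVal.mono fun θ h => Dset_subset_DigitSeq h.1)
  have hc : IsCompact {θ : ℕ → ℕ | ∀ n, θ n ∈ ({1, 2, 3, 4} : Set ℕ)} :=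
    isCompact_pi_infinite fun _ => (toFinite _).isCompact
  have h1 : IsClosed {θ : ℕ → ℕ | ∀ n, (θ n, θ (n + 1)) ∉ badPairs} := by
    rw [ofPred_forall]
    refine isClosed_iInter fun n => ?_
    have hc : Continuous fun θ : ℕ → ℕ => (θ n, θ (n + 1)) :=
      (continuous_apply n).prodMk (continuous_apply (n + 1))
    exact (isClosed_discrete badPairsᶜ).preimage hc
  have h2 : IsClosed {θ : ℕ → ℕ | θ 0 ∈ S} := (isClosed_discrete S).preimage (continuous_apply 0)
  exact (hc.inter_right h1).inter_right h2

lemma tailSet_subset_Icc (S : Set ℕ) : tailSet S ⊆ Icc 0 1 := by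
  rintro _ ⟨θ, h, rfl⟩
  exact cfVal_mem_Icc (Dset_subset_DigitSeq h.1)

@[simp] lemma app_nil (θ : ℕ → ℕ) : app [] θ = θ := by
  ext n
  simp [app]

@[simp] lemma app_cons_zero (a : ℕ) (w : List ℕ) (θ : ℕ → ℕ) : app (a :: w) θ 0 = a := by
  simp [app]

@[simp] lemma app_cons_succ (a : ℕ) (w : List ℕ) (θ : ℕ → ℕ) (n : ℕ) :
    app (a :: w) θ (n + 1) = app w θ n := by
  simp [app]

/-- The map `t ↦ [0; w, 1/t]`, i.e. `[0; θ] ↦ [0; w, θ]`. -/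
def wordMap (w : List ℕ) (t : ℝ) : ℝ := w.foldr (fun a x => 1 / ((a : ℝ) + x)) t

lemma wordMap_append (u w : List ℕ) (t : ℝ) : wordMap (u ++ w) t = wordMap u (wordMap w t) := by
  simp [wordMap]

lemma app_mem_DigitSeq {w : List ℕ} (hw : ∀ a ∈ w, 1 ≤ a ∧ a ≤ 4) {θ : ℕ → ℕ}
    (h : θ ∈ DigitSeq) : app w θ ∈ DigitSeq := by
  induction w with
  | nil => simpa using h
  | cons a w ih =>
    rw [List.forall_mem_cons] at hw
    rintro (_ | n)
    · simpa using hw.1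
    · simpa using ih hw.2 n

lemma cfVal_app {w : List ℕ} (hw : ∀ a ∈ w, 1 ≤ a ∧ a ≤ 4) {θ : ℕ → ℕ} (h : θ ∈ DigitSeq) :
    cfVal (app w θ) = wordMap w (cfVal θ) := by
  induction w with
  | nil => simp [wordMap]
  | cons a w ih =>
    rw [cfVal_eq (app_mem_DigitSeq hw h)]
    rw [List.forall_mem_cons] at hw
    simp only [app_cons_zero, app_cons_succ]
    rw [ih hw.2]
    rfl

lemma one_div_add_mem_tailSet {e : ℕ} (he : e ∈ ({1, 2, 3, 4} : Set ℕ)) {S S' : Set ℕ}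
    (heS : e ∈ S) (hS' : ∀ d ∈ S', (e, d) ∉ badPairs) {x : ℝ} (hx : x ∈ tailSet S') :
    1 / ((e : ℝ) + x) ∈ tailSet S := by
  obtain ⟨θ, ⟨hD, h0⟩, rfl⟩ := hx
  refine ⟨app [e] θ, ⟨⟨?_, ?_⟩, by simpa using heS⟩, ?_⟩
  · rintro (_ | n)
    · simpa using he
    · simpa using hD.1 n
  · rintro (_ | n)
    · simpa using hS' _ h0
    · simpa using hD.2 n
  · rw [cfVal_app _ (Dset_subset_DigitSeq hD)]
    · simp [wordMap]
    · simp only [mem_insert_iff, mem_singleton_iff] at he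
      simp only [List.mem_singleton, forall_eq]
      omega

lemma Kb_append_singleton {w : List ℕ} (hw : ∀ a ∈ w, 1 ≤ a ∧ a ≤ 4) {d : ℕ}
    (hd : 1 ≤ d ∧ d ≤ 4) {S : Set ℕ}
    (hS : ∀ e ∈ ({1, 2, 3, 4} : Set ℕ), e ∈ S ↔ (d, e) ∉ badPairs) :
    Kb (w ++ [d]) = wordMap (w ++ [d]) '' tailSet S := by
  have hw' : ∀ a ∈ w ++ [d], 1 ≤ a ∧ a ≤ 4 := by
    intro a ha
    rcases List.mem_append.1 ha with h | h
    · exact hw a h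
    · rw [List.mem_singleton.1 h]
      exact hd
  ext x
  simp only [Kb, tailSet, mem_ofPred_eq, mem_image, exists_exists_and_eq_and,
    List.getLast?_concat, Option.some.injEq, forall_eq']
  constructor
  · rintro ⟨θ, hD, hb, rfl⟩
    exact ⟨θ, ⟨hD, (hS _ (hD.1 0)).2 hb⟩, (cfVal_app hw' (Dset_subset_DigitSeq hD)).symm⟩
  · rintro ⟨θ, ⟨hD, hb⟩, rfl⟩
    exact ⟨θ, hD, (hS _ (hD.1 0)).1 hb, (cfVal_app hw' (Dset_subset_DigitSeq hD)).symm⟩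

lemma per13_tail : (fun i => per13 (i + 1)) = per31 := by
  ext n
  simp only [per13, per31]
  split_ifs <;> omega

lemma per31_tail : (fun i => per31 (i + 1)) = per13 := by
  ext n
  simp only [per13, per31]
  split_ifs <;> omega

lemma per13_mem_Dset : per13 ∈ Dset := by
  constructor <;> intro n <;> simp only [per13, badPairs] <;> split_ifs <;> simp

lemma per31_mem_Dset : per31 ∈ Dset := by
  constructor <;> intro n <;> simp only [per31, badPairs] <;> split_ifs <;> simp

/-- The largest value `[0; θ]` with `θ ∈ D`. -/
def valMax : ℝ := cfVal per13

/-- The smallest value `[0; θ]` with `θ ∈ D` and `θ_1 ≠ 4`. -/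
def valMid : ℝ := cfVal per31

/-- The smallest value `[0; θ]` with `θ ∈ D`. -/
def valMin : ℝ := 1 / (4 + valMax)

lemma valMax_eq : valMax = 1 / (1 + valMid) := by
  rw [valMax, cfVal_eq (Dset_subset_DigitSeq per13_mem_Dset), per13_tail]
  simp [per13, valMid]

lemma valMid_eq : valMid = 1 / (3 + valMax) := by
  rw [valMid, cfVal_eq (Dset_subset_DigitSeq per31_mem_Dset), per31_tail]
  simp [per31, valMax]

lemma valMax_mem : valMax ∈ Icc (0.79128784 : ℝ) 0.79128785 := by
  have h0 : valMax ∈ Icc (0 : ℝ) 1 := cfVal_mem_Icc (Dset_subset_DigitSeq per13_mem_Dset)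
  have h : valMax * (4 + valMax) = 3 + valMax := by
    have h1 := valMax_eq
    have h3 : 0 < 3 + valMax := by linarith [h0.1]
    rw [valMid_eq, show 1 / (1 + 1 / (3 + valMax)) = (3 + valMax) / (4 + valMax) by
      rw [one_add_div h3.ne', one_div_div]; ring, eq_div_iff (by linarith)] at h1
    exact h1
  constructor <;> nlinarith [h0.1, h0.2]

lemma valMid_mem : valMid ∈ Icc (1 / (3 + 0.79128785) : ℝ) (1 / (3 + 0.79128784)) := by
  rw [valMid_eq]
  exact one_div_add_mem_Icc (by norm_num) (by norm_num) valMax_mem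

lemma valMin_mem : valMin ∈ Icc (1 / (4 + 0.79128785) : ℝ) (1 / (4 + 0.79128784)) :=
  one_div_add_mem_Icc (by norm_num) (by norm_num) valMax_mem

lemma cfVal_bounds_approx (n : ℕ) {θ : ℕ → ℕ} (h : θ ∈ Dset) :
    cfVal θ ≤ valMax + (5 / 6) ^ n ∧ valMin - (5 / 6) ^ n ≤ cfVal θ ∧
      (θ 0 ≠ 4 → valMid - (5 / 6) ^ n ≤ cfVal θ) := by
  have hα := valMax_mem
  have hβ := valMid_mem
  have hγ := valMin_mem
  norm_num at hα hβ hγ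
  induction n generalizing θ with
  | zero =>
    have h1 := cfVal_mem_Icc (Dset_subset_DigitSeq h)
    norm_num
    exact ⟨by linarith [h1.2], by linarith [h1.1], fun _ => by linarith [h1.1]⟩
  | succ n ih =>
    have htD : (fun i => θ (i + 1)) ∈ Dset := ⟨fun i => h.1 (i + 1), fun i => h.2 (i + 1)⟩
    obtain ⟨i1, i2, i3⟩ := ih htD
    have ht := cfVal_mem_Icc (Dset_subset_DigitSeq htD)
    have hb := h.2 0
    have hd := h.1 0
    rw [cfVal_eq (Dset_subset_DigitSeq h)]
    set t := cfVal fun i => θ (i + 1)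
    have hε : (0 : ℝ) < (5 / 6) ^ n := by positivity
    rw [pow_succ']
    set ε : ℝ := (5 / 6) ^ n
    simp only [mem_insert_iff, mem_singleton_iff] at hd
    have hup : 2 ≤ θ 0 → 1 / ((θ 0 : ℝ) + t) ≤ 1 / 2 := fun h2 => by
      have h2' : (2 : ℝ) ≤ θ 0 := by exact_mod_cast h2
      exact one_div_le_one_div_of_le (by norm_num) (by linarith [ht.1])
    have hlow : ∀ e : ℝ, 3 ≤ e →
        1 / (e + valMax) - 5 / 6 * ε ≤ 1 / (e + t) := fun e he => by
      rw [sub_le_iff_le_add, div_add' _ _ _ (by linarith [ht.1]),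
        div_le_div_iff₀ (by linarith) (by linarith [ht.1])]
      have : 0 ≤ (e + t) * (e + valMax - 1) := mul_nonneg (by linarith [ht.1]) (by linarith)
      nlinarith [ht.1]
    have hthird : θ 0 ≤ 2 → 1 / 3 ≤ 1 / ((θ 0 : ℝ) + t) := fun h2 => by
      have h2' : (θ 0 : ℝ) ≤ 2 := by exact_mod_cast h2
      exact one_div_le_one_div_of_le (by linarith [DigitSeq.one_le (Dset_subset_DigitSeq h), ht.1])
        (by linarith [ht.2])
    have h3 := hlow 3 le_rfl
    have h4 := hlow 4 (by norm_num)
    rw [← valMid_eq] at h3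
    rw [← valMin] at h4
    rcases hd with hd | hd | hd | hd
    · have := hthird (by omega)
      refine ⟨?_, by linarith, fun _ => by linarith⟩
      have h5 : valMid - ε ≤ t := i3 fun h4 => by
        simp only [hd, h4, badPairs] at hb
        simp at hb
      rw [hd, valMax_eq, Nat.cast_one, div_add' _ _ _ (by linarith),
        div_le_div_iff₀ (by linarith [ht.1]) (by linarith)]
      have h6 : ε ≤ 5 / 6 * ε * (1 + valMid) := by nlinarith
      nlinarith [mul_nonneg (hε.le.trans h6) ht.1]
    · have := hthird (by omega)
      exact ⟨by linarith [hup (by omega)], by linarith, fun _ => by linarith⟩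
    · refine ⟨by linarith [hup (by omega)], ?_, fun _ => ?_⟩ <;> rw [hd] <;> push_cast <;> linarith
    · refine ⟨by linarith [hup (by omega)], ?_, fun h => absurd hd h⟩
      rw [hd]
      push_cast
      linarith

lemma cfVal_bounds {θ : ℕ → ℕ} (h : θ ∈ Dset) :
    cfVal θ ≤ valMax ∧ valMin ≤ cfVal θ ∧ (θ 0 ≠ 4 → valMid ≤ cfVal θ) := by
  have ht : Tendsto (fun n : ℕ => (5 / 6 : ℝ) ^ n) atTop (𝓝 0) :=
    tendsto_pow_atTop_nhds_zero_of_lt_one (by norm_num) (by norm_num)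
  refine ⟨?_, ?_, fun h4 => ?_⟩
  · simpa using ge_of_tendsto' (ht.const_add valMax) fun n => (cfVal_bounds_approx n h).1
  · simpa using le_of_tendsto' (ht.const_sub valMin) fun n => (cfVal_bounds_approx n h).2.1
  · simpa using le_of_tendsto' (ht.const_sub valMid) fun n => (cfVal_bounds_approx n h).2.2 h4
/-- `f` behaves on `[0, 1]` like a Möbius map of determinant `κ` whose denominator `q + q' t`
satisfies `0 ≤ q' ≤ q`. -/
def IsMobius (κ : ℝ) (f : ℝ → ℝ) : Prop :=
  ∃ q q' : ℝ, 0 < q ∧ 0 ≤ q' ∧ q' ≤ q ∧ ∀ x ∈ Icc (0 : ℝ) 1, ∀ y ∈ Icc (0 : ℝ) 1,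
    f y - f x = κ * (y - x) / ((q + q' * x) * (q + q' * y))

lemma IsMobius.comp_one_div_add {κ : ℝ} {f : ℝ → ℝ} (h : IsMobius κ f) {e : ℝ} (he : 1 ≤ e) :
    IsMobius (-κ) fun t => f (1 / (e + t)) := by
  obtain ⟨q, q', hq, hq', hqq, h⟩ := h
  refine ⟨q * e + q', q, by positivity, hq.le, by nlinarith, fun x hx y hy => ?_⟩
  rw [h _ (one_div_add_mem_unitInterval he hx) _ (one_div_add_mem_unitInterval he hy)]
  have hx0 : 0 < e + x := by linarith [hx.1]
  have hy0 : 0 < e + y := by linarith [hy.1]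
  have h1 : q + q' * (1 / (e + x)) = (q * e + q' + q * x) / (e + x) := by
    field_simp
    ring
  have h2 : q + q' * (1 / (e + y)) = (q * e + q' + q * y) / (e + y) := by
    field_simp
    ring
  have h3 : 0 < q * e + q' + q * x := by have := hx.1; positivity
  have h4 : 0 < q * e + q' + q * y := by have := hy.1; positivity
  rw [h1, h2]
  field_simp
  ring

lemma IsMobius.lt {κ : ℝ} {f : ℝ → ℝ} (h : IsMobius κ f) {x y : ℝ} (hκ : 0 < κ) (hx : 0 ≤ x)
    (hxy : x < y) (hy : y ≤ 1) : f x < f y := by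
  obtain ⟨q, q', hq, hq', -, h⟩ := h
  have hy0 : 0 ≤ y := hx.trans hxy.le
  rw [← sub_pos, h x ⟨hx, hxy.le.trans hy⟩ y ⟨hy0, hy⟩]
  have := sub_pos.2 hxy
  positivity

lemma IsMobius.neg {κ : ℝ} {f : ℝ → ℝ} (h : IsMobius κ f) : IsMobius (-κ) fun t => -f t := by
  obtain ⟨q, q', hq, hq', hqq, h⟩ := h
  refine ⟨q, q', hq, hq', hqq, fun x hx y hy => ?_⟩
  rw [neg_mul, neg_div, ← h x hx y hy]
  ring

lemma IsMobius.gt {κ : ℝ} {f : ℝ → ℝ} (h : IsMobius κ f) {x y : ℝ} (hκ : κ < 0) (hx : 0 ≤ x)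
    (hxy : x < y) (hy : y ≤ 1) : f y < f x :=
  neg_lt_neg_iff.1 (h.neg.lt (neg_pos.2 hκ) hx hxy hy)

lemma IsMobius.continuousOn {κ : ℝ} {f : ℝ → ℝ} (h : IsMobius κ f) :
    ContinuousOn f (Icc 0 1) := by
  obtain ⟨q, q', hq, hq', -, h⟩ := h
  have h0 : (0 : ℝ) ∈ Icc (0 : ℝ) 1 := ⟨le_rfl, zero_le_one⟩
  have hg : ContinuousOn (fun y => f 0 + κ * (y - 0) / ((q + q' * 0) * (q + q' * y)))
      (Icc 0 1) := by
    refine continuousOn_const.add (ContinuousOn.div (by fun_prop) (by fun_prop) fun y hy => ?_)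
    have := hy.1
    positivity
  exact hg.congr fun y hy => by
    change f y = f 0 + κ * (y - 0) / ((q + q' * 0) * (q + q' * y))
    rw [← h 0 h0 y hy]
    ring

lemma IsMobius.abs_sub_le {κ : ℝ} {f : ℝ → ℝ} (h : IsMobius κ f) {C : ℝ} (hC : 0 ≤ C)
    {x₁ y₁ x₂ y₂ a₁ b₁ a₂ b₂ a₃ b₃ a₄ b₄ : ℝ} (hx₁ : x₁ ∈ Icc a₁ b₁) (hy₁ : y₁ ∈ Icc a₂ b₂)
    (hx₂ : x₂ ∈ Icc a₃ b₃) (hy₂ : y₂ ∈ Icc a₄ b₄)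
    (hle : 0 ≤ a₁ ∧ b₁ ≤ a₂ ∧ b₂ ≤ 1 ∧ 0 ≤ a₃ ∧ b₃ ≤ a₄ ∧ b₄ ≤ 1 ∧
      b₂ - a₁ ≤ C * (a₄ - b₃) ∧
      (b₂ - a₁) * (2 + b₃ + b₄) ≤ C * (a₄ - b₃) * (2 + a₁ + a₂) ∧
      (b₂ - a₁) * ((1 + b₃) * (1 + b₄)) ≤ C * (a₄ - b₃) * ((1 + a₁) * (1 + a₂))) :
    |f y₁ - f x₁| ≤ C * |f y₂ - f x₂| := by
  obtain ⟨q, q', hq, hq', hqq, h⟩ := h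
  obtain ⟨hx1, hx1'⟩ := hx₁
  obtain ⟨hy1, hy1'⟩ := hy₁
  obtain ⟨hx2, hx2'⟩ := hx₂
  obtain ⟨hy2, hy2'⟩ := hy₂
  obtain ⟨p1, p2, p3, p4, p5, p6, c1, c2, c3⟩ := hle
  obtain ⟨s, rfl⟩ : ∃ s, q = q' + s := ⟨q - q', by ring⟩
  have hs : 0 ≤ s := by linarith
  rw [h x₁ ⟨by linarith, by linarith⟩ y₁ ⟨by linarith, by linarith⟩,
    h x₂ ⟨by linarith, by linarith⟩ y₂ ⟨by linarith, by linarith⟩]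
  have hx10 : 0 ≤ x₁ := by linarith
  have hy10 : 0 ≤ y₁ := by linarith
  have hx20 : 0 ≤ x₂ := by linarith
  have hy20 : 0 ≤ y₂ := by linarith
  have A1 : 0 < (q' + s + q' * x₁) * (q' + s + q' * y₁) := by positivity
  have A2 : 0 < (q' + s + q' * x₂) * (q' + s + q' * y₂) := by positivity
  have d1 : 0 ≤ y₁ - x₁ := by linarith
  have d2 : 0 ≤ y₂ - x₂ := by linarith
  rw [abs_div, abs_div, abs_of_pos A1, abs_of_pos A2, abs_mul, abs_mul, abs_of_nonneg d1,
    abs_of_nonneg d2, ← mul_div_assoc, div_le_div_iff₀ A1 A2]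
  have hD1 : y₁ - x₁ ≤ b₂ - a₁ := by linarith
  have hD2 : C * (a₄ - b₃) ≤ C * (y₂ - x₂) := mul_le_mul_of_nonneg_left (by linarith) hC
  have hC2 : 0 ≤ C * (y₂ - x₂) := mul_nonneg hC d2
  have ha1 : 0 ≤ a₂ := by linarith
  have k1 : y₁ - x₁ ≤ C * (y₂ - x₂) := by linarith
  have k2 : (y₁ - x₁) * (2 + x₂ + y₂) ≤ C * (y₂ - x₂) * (2 + x₁ + y₁) :=
    calc _ ≤ (b₂ - a₁) * (2 + b₃ + b₄) := by gcongr; linarith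
      _ ≤ _ := c2
      _ ≤ _ := by gcongr
  have k3 : (y₁ - x₁) * ((1 + x₂) * (1 + y₂)) ≤ C * (y₂ - x₂) * ((1 + x₁) * (1 + y₁)) :=
    calc _ ≤ (b₂ - a₁) * ((1 + b₃) * (1 + b₄)) := by gcongr <;> linarith
      _ ≤ _ := c3
      _ ≤ _ := by gcongr
  have k : (y₁ - x₁) * ((q' + s + q' * x₂) * (q' + s + q' * y₂)) ≤
      C * (y₂ - x₂) * ((q' + s + q' * x₁) * (q' + s + q' * y₁)) := by
    have e1 := mul_le_mul_of_nonneg_left k1 (mul_nonneg hs hs)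
    have e2 := mul_le_mul_of_nonneg_left k2 (mul_nonneg hs hq')
    have e3 := mul_le_mul_of_nonneg_left k3 (mul_nonneg hq' hq')
    linarith
  have := mul_le_mul_of_nonneg_left k (abs_nonneg κ)
  linarith

lemma isMobius_wordMap {w : List ℕ} (hw : ∀ a ∈ w, 1 ≤ a) :
    IsMobius ((-1) ^ w.length) (wordMap w) := by
  induction w using List.reverseRecOn with
  | nil => exact ⟨1, 0, one_pos, le_rfl, zero_le_one, fun x _ y _ => by simp [wordMap]⟩
  | append_singleton w d ih =>
    have hd : (1 : ℝ) ≤ d := by exact_mod_cast hw d (by simp)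
    have h := (ih fun a ha => hw a (by simp [ha])).comp_one_div_add hd
    have h1 : wordMap (w ++ [d]) = fun t => wordMap w (1 / ((d : ℝ) + t)) := by
      ext t
      rw [wordMap_append]
      rfl
    rw [h1, List.length_append, List.length_singleton, pow_succ, mul_neg_one]
    exact h

/-- The digit sets `S` occurring when `tailSet S` is split recursively, with the smallest and
largest elements `lo`, `hi` of `tailSet S` and its gap `(gl, gu)` above the smaller first digits
being separated. -/
inductive IsBlock : Set ℕ → ℝ → ℝ → ℝ → ℝ → Prop
  | one_to_three : IsBlock {1, 2, 3} valMid (1 / (2 + valMid)) (1 / (1 + valMax)) valMax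
  | two_to_three : IsBlock {2, 3} valMid (1 / (3 + valMin)) (1 / (2 + valMax)) (1 / (2 + valMid))
  | one_to_four : IsBlock {1, 2, 3, 4} valMin (1 / (2 + valMid)) (1 / (1 + valMax)) valMax
  | two_to_four :
      IsBlock {2, 3, 4} valMin (1 / (3 + valMin)) (1 / (2 + valMax)) (1 / (2 + valMid))
  | three_to_four : IsBlock {3, 4} valMin (1 / (4 + valMin)) valMid (1 / (3 + valMin))

lemma IsBlock.order {S : Set ℕ} {lo gl gu hi : ℝ} (h : IsBlock S lo gl gu hi) :
    0 ≤ lo ∧ lo < gl ∧ gl < gu ∧ gu < hi ∧ hi ≤ 1 := by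
  have hα := valMax_mem
  have hβ := valMid_mem
  have hγ := valMin_mem
  have h1α := one_div_add_mem_Icc (e := 1) (by norm_num) (by norm_num) hα
  have h2α := one_div_add_mem_Icc (e := 2) (by norm_num) (by norm_num) hα
  have h2β := one_div_add_mem_Icc (e := 2) (by norm_num) (by norm_num) hβ
  have h3γ := one_div_add_mem_Icc (e := 3) (by norm_num) (by norm_num) hγ
  have h4γ := one_div_add_mem_Icc (e := 4) (by norm_num) (by norm_num) hγ
  have lt : ∀ {x y a b c d : ℝ}, x ∈ Icc a b → y ∈ Icc c d → b < c → x < y :=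
    fun h1 h2 h => h1.2.trans_lt (h.trans_le h2.1)
  have p0 : (0 : ℝ) ∈ Icc (0 : ℝ) 0 := by simp
  have p1 : (1 : ℝ) ∈ Icc (1 : ℝ) 1 := by simp
  cases h
  · exact ⟨(lt p0 hβ (by norm_num)).le, lt hβ h2β (by norm_num), lt h2β h1α (by norm_num),
      lt h1α hα (by norm_num), (lt hα p1 (by norm_num)).le⟩
  · exact ⟨(lt p0 hβ (by norm_num)).le, lt hβ h3γ (by norm_num), lt h3γ h2α (by norm_num),
      lt h2α h2β (by norm_num), (lt h2β p1 (by norm_num)).le⟩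
  · exact ⟨(lt p0 hγ (by norm_num)).le, lt hγ h2β (by norm_num), lt h2β h1α (by norm_num),
      lt h1α hα (by norm_num), (lt hα p1 (by norm_num)).le⟩
  · exact ⟨(lt p0 hγ (by norm_num)).le, lt hγ h3γ (by norm_num), lt h3γ h2α (by norm_num),
      lt h2α h2β (by norm_num), (lt h2β p1 (by norm_num)).le⟩
  · exact ⟨(lt p0 hγ (by norm_num)).le, lt hγ h4γ (by norm_num), lt h4γ hβ (by norm_num),
      lt hβ h3γ (by norm_num), (lt h3γ p1 (by norm_num)).le⟩

lemma valMax_mem_tailSet {S : Set ℕ} (h : 1 ∈ S) : valMax ∈ tailSet S :=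
  ⟨per13, ⟨per13_mem_Dset, h⟩, rfl⟩

lemma valMid_mem_tailSet {S : Set ℕ} (h : 3 ∈ S) : valMid ∈ tailSet S :=
  ⟨per31, ⟨per31_mem_Dset, h⟩, rfl⟩

lemma valMin_mem_tailSet {S : Set ℕ} (h : 4 ∈ S) : valMin ∈ tailSet S := by
  have := one_div_add_mem_tailSet (e := 4) (by simp) h (S' := {1}) (by simp [badPairs])
    (valMax_mem_tailSet rfl)
  exact_mod_cast this

lemma IsBlock.hi_mem {S : Set ℕ} {lo gl gu hi : ℝ} (h : IsBlock S lo gl gu hi) :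
    hi ∈ tailSet S := by
  have h2 : ∀ S : Set ℕ, 2 ∈ S → 1 / (2 + valMid) ∈ tailSet S := fun S hS => by
    exact_mod_cast one_div_add_mem_tailSet (e := 2) (by simp) hS (S' := {3}) (by simp [badPairs])
      (valMid_mem_tailSet rfl)
  have h3 : ∀ S : Set ℕ, 3 ∈ S → 1 / (3 + valMin) ∈ tailSet S := fun S hS => by
    exact_mod_cast one_div_add_mem_tailSet (e := 3) (by simp) hS (S' := {4}) (by simp [badPairs])
      (valMin_mem_tailSet rfl)
  cases h
  · exact valMax_mem_tailSet (by simp)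
  · exact h2 _ (by simp)
  · exact valMax_mem_tailSet (by simp)
  · exact h2 _ (by simp)
  · exact h3 _ (by simp)

/-- `K` is the image of some `tailSet S` under a Möbius map, its hull has end points `a` and `d`
(in some order), and the first gap that is removed from the hull has length `g`. -/
def IsPiece (a d g : ℝ) (K : Set ℝ) : Prop :=
  ∃ S lo gl gu hi κ f, IsBlock S lo gl gu hi ∧ κ ≠ 0 ∧ IsMobius κ f ∧
    (a = f lo ∧ d = f hi ∨ a = f hi ∧ d = f lo) ∧ g = |f gu - f gl| ∧ K = f '' tailSet S

lemma IsPiece.symm {a d g : ℝ} {K : Set ℝ} (h : IsPiece a d g K) : IsPiece d a g K := by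
  obtain ⟨S, lo, gl, gu, hi, κ, f, hS, hκ, hf, hends, hg, hK⟩ := h
  exact ⟨S, lo, gl, gu, hi, κ, f, hS, hκ, hf, hends.symm.imp And.symm And.symm, hg, hK⟩

lemma IsBlock.isPiece {S : Set ℕ} {lo gl gu hi : ℝ} (h : IsBlock S lo gl gu hi) {κ : ℝ}
    {f : ℝ → ℝ} (hκ : κ ≠ 0) (hf : IsMobius κ f) :
    IsPiece (f lo) (f hi) |f gu - f gl| (f '' tailSet S) :=
  ⟨S, lo, gl, gu, hi, κ, f, h, hκ, hf, Or.inl ⟨rfl, rfl⟩, rfl, rfl⟩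

lemma IsBlock.isPiece_comp {S : Set ℕ} {lo gl gu hi : ℝ} (h : IsBlock S lo gl gu hi) {κ : ℝ}
    {f : ℝ → ℝ} (hκ : κ ≠ 0) (hf : IsMobius κ f) {e : ℝ} (he : 1 ≤ e) :
    IsPiece (f (1 / (e + hi))) (f (1 / (e + lo))) |f (1 / (e + gl)) - f (1 / (e + gu))|
      ((fun t => f (1 / (e + t))) '' tailSet S) := by
  rw [abs_sub_comm]
  exact (h.isPiece (neg_ne_zero.2 hκ) (hf.comp_one_div_add he)).symm

lemma image_comp_subset {f : ℝ → ℝ} {e : ℕ} (he : e ∈ ({1, 2, 3, 4} : Set ℕ)) {S S' : Set ℕ}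
    (heS : e ∈ S) (hS' : ∀ d ∈ S', (e, d) ∉ badPairs) {r : ℝ} (hr : (e : ℝ) = r) :
    (fun t => f (1 / (r + t))) '' tailSet S' ⊆ f '' tailSet S := by
  rintro _ ⟨t, ht, rfl⟩
  exact ⟨_, hr ▸ one_div_add_mem_tailSet he heS hS' ht, rfl⟩

lemma tailSet_mono {S S' : Set ℕ} (h : S' ⊆ S) : tailSet S' ⊆ tailSet S :=
  image_mono fun _ hθ => ⟨hθ.1, h hθ.2⟩

lemma IsBlock.split {S : Set ℕ} {lo gl gu hi : ℝ} (h : IsBlock S lo gl gu hi) {κ : ℝ}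
    {f : ℝ → ℝ} (hκ : κ ≠ 0) (hf : IsMobius κ f) :
    ∃ g₁ g₂ K₁ K₂, IsPiece (f lo) (f gl) g₁ K₁ ∧ IsPiece (f gu) (f hi) g₂ K₂ ∧
      K₁ ⊆ f '' tailSet S ∧ K₂ ⊆ f '' tailSet S ∧
      g₁ ≤ |f gu - f gl| ∧ g₂ ≤ |f gu - f gl| ∧
      |f gu - f gl| ≤ |f gl - f lo| ∧ |f gu - f gl| ≤ |f hi - f gu| ∧
      |f hi - f lo| ≤ 6 * |f gu - f gl| := by
  have hα := valMax_mem
  have hβ := valMid_mem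
  have hγ := valMin_mem
  have h1α := one_div_add_mem_Icc (e := 1) (by norm_num) (by norm_num) hα
  have h2α := one_div_add_mem_Icc (e := 2) (by norm_num) (by norm_num) hα
  have h2β := one_div_add_mem_Icc (e := 2) (by norm_num) (by norm_num) hβ
  have h3γ := one_div_add_mem_Icc (e := 3) (by norm_num) (by norm_num) hγ
  have h4γ := one_div_add_mem_Icc (e := 4) (by norm_num) (by norm_num) hγ
  have hle : ∀ {x₁ y₁ x₂ y₂ a₁ b₁ a₂ b₂ a₃ b₃ a₄ b₄ : ℝ} (hx₁ : x₁ ∈ Icc a₁ b₁)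
      (hy₁ : y₁ ∈ Icc a₂ b₂) (hx₂ : x₂ ∈ Icc a₃ b₃) (hy₂ : y₂ ∈ Icc a₄ b₄)
      (hle : 0 ≤ a₁ ∧ b₁ ≤ a₂ ∧ b₂ ≤ 1 ∧ 0 ≤ a₃ ∧ b₃ ≤ a₄ ∧ b₄ ≤ 1 ∧
        b₂ - a₁ ≤ 1 * (a₄ - b₃) ∧
        (b₂ - a₁) * (2 + b₃ + b₄) ≤ 1 * (a₄ - b₃) * (2 + a₁ + a₂) ∧
        (b₂ - a₁) * ((1 + b₃) * (1 + b₄)) ≤ 1 * (a₄ - b₃) * ((1 + a₁) * (1 + a₂))),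
      |f y₁ - f x₁| ≤ |f y₂ - f x₂| := fun h1 h2 h3 h4 h => by
    simpa using hf.abs_sub_le zero_le_one h1 h2 h3 h4 h
  have inv : ∀ {e x a b : ℝ}, 1 ≤ e → 0 ≤ a → x ∈ Icc a b →
    1 / (e + x) ∈ Icc (1 / (e + b)) (1 / (e + a)) := one_div_add_mem_Icc
  cases h
  · have hU := IsBlock.one_to_three.isPiece_comp hκ hf (e := 1) (by norm_num)
    rw [← valMax_eq] at hU
    exact ⟨_, _, _, _, IsBlock.two_to_three.isPiece hκ hf, hU,
      image_mono (tailSet_mono (by simp)),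
      image_comp_subset (e := 1) (by simp) (by simp) (by simp [badPairs]) (by simp),
      hle h3γ h2α h2β h1α (by norm_num),
      hle (inv (by norm_num) (by norm_num) h1α) (inv (by norm_num) (by norm_num) h2β)
        h2β h1α (by norm_num),
      hle h2β h1α hβ h2β (by norm_num),
      hle h2β h1α h1α hα (by norm_num),
      hf.abs_sub_le (by norm_num) hβ hα h2β h1α (by norm_num)⟩
  · have hU := IsBlock.one_to_three.isPiece_comp hκ hf (e := 2) (by norm_num)
    have hL := IsBlock.one_to_four.isPiece_comp hκ hf (e := 3) (by norm_num)
    rw [← valMid_eq] at hL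
    exact ⟨_, _, _, _, hL, hU,
      image_comp_subset (e := 3) (by simp) (by simp) (by simp [badPairs]) (by simp),
      image_comp_subset (e := 2) (by simp) (by simp) (by simp [badPairs]) (by simp),
      hle (inv (by norm_num) (by norm_num) h1α) (inv (by norm_num) (by norm_num) h2β)
        h3γ h2α (by norm_num),
      hle (inv (by norm_num) (by norm_num) h1α) (inv (by norm_num) (by norm_num) h2β)
        h3γ h2α (by norm_num),
      hle h3γ h2α hβ h3γ (by norm_num),
      hle h3γ h2α h2α h2β (by norm_num),
      hf.abs_sub_le (by norm_num) hβ h2β h3γ h2α (by norm_num)⟩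
  · have hU := IsBlock.one_to_three.isPiece_comp hκ hf (e := 1) (by norm_num)
    rw [← valMax_eq] at hU
    exact ⟨_, _, _, _, IsBlock.two_to_four.isPiece hκ hf, hU,
      image_mono (tailSet_mono (by simp)),
      image_comp_subset (e := 1) (by simp) (by simp) (by simp [badPairs]) (by simp),
      hle h3γ h2α h2β h1α (by norm_num),
      hle (inv (by norm_num) (by norm_num) h1α) (inv (by norm_num) (by norm_num) h2β)
        h2β h1α (by norm_num),
      hle h2β h1α hγ h2β (by norm_num),
      hle h2β h1α h1α hα (by norm_num),
      hf.abs_sub_le (by norm_num) hγ hα h2β h1α (by norm_num)⟩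
  · have hU := IsBlock.one_to_three.isPiece_comp hκ hf (e := 2) (by norm_num)
    exact ⟨_, _, _, _, IsBlock.three_to_four.isPiece hκ hf, hU,
      image_mono (tailSet_mono (by simp)),
      image_comp_subset (e := 2) (by simp) (by simp) (by simp [badPairs]) (by simp),
      hle h4γ hβ h3γ h2α (by norm_num),
      hle (inv (by norm_num) (by norm_num) h1α) (inv (by norm_num) (by norm_num) h2β)
        h3γ h2α (by norm_num),
      hle h3γ h2α hγ h3γ (by norm_num),
      hle h3γ h2α h2α h2β (by norm_num),
      hf.abs_sub_le (by norm_num) hγ h2β h3γ h2α (by norm_num)⟩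
  · have hU := IsBlock.one_to_four.isPiece_comp hκ hf (e := 3) (by norm_num)
    rw [← valMid_eq] at hU
    have hL := IsBlock.one_to_four.isPiece_comp hκ hf (e := 4) (by norm_num)
    rw [← valMin] at hL
    exact ⟨_, _, _, _, hL, hU,
      image_comp_subset (e := 4) (by simp) (by simp) (by simp [badPairs]) (by simp),
      image_comp_subset (e := 3) (by simp) (by simp) (by simp [badPairs]) (by simp),
      hle (inv (by norm_num) (by norm_num) h1α) (inv (by norm_num) (by norm_num) h2β)
        h4γ hβ (by norm_num),
      hle (inv (by norm_num) (by norm_num) h1α) (inv (by norm_num) (by norm_num) h2β)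
        h4γ hβ (by norm_num),
      hle h4γ hβ hγ h4γ (by norm_num),
      hle h4γ hβ hβ h3γ (by norm_num),
      hf.abs_sub_le (by norm_num) hγ h3γ h4γ hβ (by norm_num)⟩

lemma IsPiece.split {a d g : ℝ} {K : Set ℝ} (h : IsPiece a d g K) (had : a < d) :
    ∃ b c g₁ g₂ K₁ K₂, IsPiece a b g₁ K₁ ∧ IsPiece c d g₂ K₂ ∧ a < b ∧ c < d ∧ c - b = g ∧
      g ≤ b - a ∧ g ≤ d - c ∧ g₁ ≤ g ∧ g₂ ≤ g ∧ d - a ≤ 6 * g ∧ K₁ ⊆ K ∧ K₂ ⊆ K := by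
  obtain ⟨S, lo, gl, gu, hi, κ, f, hS, hκ, hf, hends, rfl, rfl⟩ := h
  obtain ⟨g₁, g₂, K₁, K₂, p1, p2, k1, k2, i1, i2, i3, i4, i5⟩ := hS.split hκ hf
  obtain ⟨o1, o2, o3, o4, o5⟩ := hS.order
  rcases lt_or_gt_of_ne hκ with hneg | hpos
  · have j1 := hf.gt hneg o1 o2 (by linarith)
    have j2 := hf.gt hneg (by linarith) o3 (by linarith)
    have j3 := hf.gt hneg (by linarith) o4 o5
    rw [abs_of_neg (by linarith : f gu - f gl < 0)] at *
    rw [abs_of_neg (by linarith : f gl - f lo < 0)] at i3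
    rw [abs_of_neg (by linarith : f hi - f gu < 0)] at i4
    rw [abs_of_neg (by linarith : f hi - f lo < 0)] at i5
    rcases hends with ⟨rfl, rfl⟩ | ⟨rfl, rfl⟩
    · linarith
    · exact ⟨f gu, f gl, g₂, g₁, K₂, K₁, p2.symm, p1.symm, by linarith, by linarith, by linarith,
        by linarith, by linarith, by linarith, by linarith, by linarith, k2, k1⟩
  · have j1 := hf.lt hpos o1 o2 (by linarith)
    have j2 := hf.lt hpos (by linarith) o3 (by linarith)
    have j3 := hf.lt hpos (by linarith) o4 o5
    rw [abs_of_pos (by linarith : 0 < f gu - f gl)] at *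
    rw [abs_of_pos (by linarith : 0 < f gl - f lo)] at i3
    rw [abs_of_pos (by linarith : 0 < f hi - f gu)] at i4
    rw [abs_of_pos (by linarith : 0 < f hi - f lo)] at i5
    rcases hends with ⟨rfl, rfl⟩ | ⟨rfl, rfl⟩
    · exact ⟨f gl, f gu, g₁, g₂, K₁, K₂, p1, p2, by linarith, by linarith, by linarith,
        by linarith, by linarith, by linarith, by linarith, by linarith, k1, k2⟩
    · linarith

lemma IsPiece.exists_mem_Icc {a d g : ℝ} {K : Set ℝ} (h : IsPiece a d g K) (had : a < d) :
    ∃ k ∈ K, k ∈ Icc a d := by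
  obtain ⟨S, lo, gl, gu, hi, κ, f, hS, hκ, hf, hends, rfl, rfl⟩ := h
  refine ⟨f hi, ⟨hi, hS.hi_mem, rfl⟩, ?_⟩
  rcases hends with ⟨rfl, rfl⟩ | ⟨rfl, rfl⟩
  · exact right_mem_Icc.2 had.le
  · exact left_mem_Icc.2 had.le

lemma IsPiece.exists_near_add (n : ℕ) {x a d g a' d' g' : ℝ} {K K' : Set ℝ}
    (h : IsPiece a d g K) (h' : IsPiece a' d' g' K') (had : a < d) (had' : a' < d')
    (hg : g ≤ d' - a') (hg' : g' ≤ d - a) (hx : x ∈ Icc (a + a') (d + d')) :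
    ∃ k ∈ K, ∃ k' ∈ K', |x - (k + k')| ≤ (5 / 6) ^ n * (d - a + (d' - a')) := by
  induction n generalizing a d g K a' d' g' K' with
  | zero =>
    obtain ⟨k, hk, hk1, hk2⟩ := h.exists_mem_Icc had
    obtain ⟨k', hk', hk1', hk2'⟩ := h'.exists_mem_Icc had'
    refine ⟨k, hk, k', hk', ?_⟩
    rw [pow_zero, one_mul, abs_le]
    constructor <;> linarith [hx.1, hx.2]
  | succ n ih =>
    have key : ∀ {a d g a' d' g' : ℝ} {K K' : Set ℝ}, IsPiece a d g K → IsPiece a' d' g' K' →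
        a < d → a' < d' → g ≤ d' - a' → g' ≤ d - a → x ∈ Icc (a + a') (d + d') → g' ≤ g →
        ∃ k ∈ K, ∃ k' ∈ K', |x - (k + k')| ≤ (5 / 6) ^ (n + 1) * (d - a + (d' - a')) := by
      intro a d g a' d' g' K K' h h' had had' hg hg' hx hgg
      obtain ⟨-, -, -, -, -, -, -, -, -, -, -, -, -, -, -, hC', -, -⟩ := h'.split had'
      obtain ⟨b, c, g₁, g₂, K₁, K₂, p1, p2, hab, hcd, hcb, hl, hr, hg1, hg2, hC, hK1, hK2⟩ :=
        h.split had
      have hpow : (0 : ℝ) ≤ (5 / 6) ^ n := by positivity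
      rcases le_total x (b + d') with hxb | hxb
      · obtain ⟨k, hk, k', hk', hle⟩ := ih p1 h' hab had' (by linarith) (by linarith)
          ⟨hx.1, hxb⟩
        refine ⟨k, hK1 hk, k', hk', hle.trans ?_⟩
        rw [pow_succ, mul_assoc]
        exact mul_le_mul_of_nonneg_left (by linarith) hpow
      · obtain ⟨k, hk, k', hk', hle⟩ := ih p2 h' hcd had' (by linarith) (by linarith)
          ⟨by linarith, hx.2⟩
        refine ⟨k, hK2 hk, k', hk', hle.trans ?_⟩
        rw [pow_succ, mul_assoc]
        exact mul_le_mul_of_nonneg_left (by linarith) hpow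
    rcases le_total g' g with hgg | hgg
    · exact key h h' had had' hg hg' hx hgg
    · obtain ⟨k', hk', k, hk, hle⟩ := key h' h had' had hg' hg
        (by rwa [add_comm a', add_comm d']) hgg
      exact ⟨k, hk, k', hk', by rwa [add_comm k, add_comm (d - a)]⟩

lemma IsPiece.add_eq_Icc {a d g a' d' g' : ℝ} {K K' : Set ℝ}
    (h : IsPiece a d g K) (h' : IsPiece a' d' g' K') (had : a < d) (had' : a' < d')
    (hg : g ≤ d' - a') (hg' : g' ≤ d - a) (hK : K ⊆ Icc a d) (hK' : K' ⊆ Icc a' d') :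
    K + K' = Icc (a + a') (d + d') := by
  have hcomp : ∀ {a d g : ℝ} {K : Set ℝ}, IsPiece a d g K → IsCompact K := by
    rintro a d g K ⟨S, lo, gl, gu, hi, κ, f, -, -, hf, -, -, rfl⟩
    exact (isCompact_tailSet S).image_of_continuousOn
      (hf.continuousOn.mono (tailSet_subset_Icc S))
  refine Subset.antisymm ?_ fun x hx => ?_
  · rintro _ ⟨k, hk, k', hk', rfl⟩
    exact ⟨add_le_add (hK hk).1 (hK' hk').1, add_le_add (hK hk).2 (hK' hk').2⟩
  · rw [← ((hcomp h).add (hcomp h')).isClosed.closure_eq, Metric.mem_closure_iff]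
    intro ε hε
    have ht : Tendsto (fun n : ℕ => (5 / 6 : ℝ) ^ n * (d - a + (d' - a'))) atTop (𝓝 0) := by
      simpa using (tendsto_pow_atTop_nhds_zero_of_lt_one (r := (5 / 6 : ℝ)) (by norm_num)
        (by norm_num)).mul_const (d - a + (d' - a'))
    obtain ⟨n, hn⟩ := (ht.eventually (gt_mem_nhds hε)).exists
    obtain ⟨k, hk, k', hk', hle⟩ := h.exists_near_add n h' had had' hg hg' hx
    exact ⟨k + k', add_mem_add hk hk', hle.trans_lt hn⟩

/-- `IsLastDigit m S lo` says that the tails following the last digit `m ∈ {2, 3, 4}` start with a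
digit in `S`, and that `lo` is the smallest value of such a tail. -/
inductive IsLastDigit : ℕ → Set ℕ → ℝ → Prop
  | two : IsLastDigit 2 {1, 2, 3} valMid
  | three : IsLastDigit 3 {1, 2, 3, 4} valMin
  | four : IsLastDigit 4 {1, 2, 3, 4} valMin

lemma IsLastDigit.isBlock {m : ℕ} {S : Set ℕ} {lo : ℝ} (h : IsLastDigit m S lo) :
    IsBlock S lo (1 / (2 + valMid)) (1 / (1 + valMax)) valMax := by
  cases h
  exacts [.one_to_three, .one_to_four, .one_to_four]

lemma isLeast_isGreatest_tailSet_one_to_three :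
    IsLeast (tailSet {1, 2, 3}) valMid ∧ IsGreatest (tailSet {1, 2, 3}) valMax := by
  refine ⟨⟨valMid_mem_tailSet (by simp), ?_⟩, valMax_mem_tailSet (by simp), ?_⟩
  · rintro _ ⟨θ, ⟨hD, h0⟩, rfl⟩
    refine (cfVal_bounds hD).2.2 fun h4 => ?_
    rw [h4] at h0
    simp at h0
  · rintro _ ⟨θ, ⟨hD, -⟩, rfl⟩
    exact (cfVal_bounds hD).1

lemma IsLastDigit.isLeast_isGreatest {m : ℕ} {S : Set ℕ} {lo : ℝ} (h : IsLastDigit m S lo) :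
    IsLeast (tailSet S) lo ∧ IsGreatest (tailSet S) valMax := by
  have h4 : IsLeast (tailSet {1, 2, 3, 4}) valMin ∧ IsGreatest (tailSet {1, 2, 3, 4}) valMax := by
    refine ⟨⟨valMin_mem_tailSet (by simp), ?_⟩, valMax_mem_tailSet (by simp), ?_⟩
    · rintro _ ⟨θ, ⟨hD, -⟩, rfl⟩
      exact (cfVal_bounds hD).2.1
    · rintro _ ⟨θ, ⟨hD, -⟩, rfl⟩
      exact (cfVal_bounds hD).1
  cases h
  exacts [isLeast_isGreatest_tailSet_one_to_three, h4, h4]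

lemma IsMobius.strictMonoOn {κ : ℝ} {f : ℝ → ℝ} (h : IsMobius κ f) (hκ : 0 < κ) :
    StrictMonoOn f (Icc 0 1) :=
  fun _ hx _ hy hxy => h.lt hκ hx.1 hxy hy.2

lemma IsMobius.strictAntiOn {κ : ℝ} {f : ℝ → ℝ} (h : IsMobius κ f) (hκ : κ < 0) :
    StrictAntiOn f (Icc 0 1) :=
  fun _ hx _ hy hxy => h.gt hκ hx.1 hxy hy.2

/-- The Möbius map of the word `1, 4, 1, d` followed by the map `f`. -/
def mapB (f : ℝ → ℝ) (d t : ℝ) : ℝ := f (1 / (1 + 1 / (4 + 1 / (1 + 1 / (d + t)))))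

/-- The Möbius map of the word `1, 3, d` followed by the map `f`. -/
def mapC (f : ℝ → ℝ) (d t : ℝ) : ℝ := f (1 / (1 + 1 / (3 + 1 / (d + t))))

lemma isMobius_mapB {f : ℝ → ℝ} (h : IsMobius 1 f) {d : ℝ} (hd : 1 ≤ d) :
    IsMobius 1 (mapB f d) := by
  have := (((h.comp_one_div_add (e := 1) le_rfl).comp_one_div_add (e := 4)
    (by norm_num)).comp_one_div_add (e := 1) le_rfl).comp_one_div_add hd
  rw [neg_neg, neg_neg] at this
  exact this

lemma isMobius_mapC {f : ℝ → ℝ} (h : IsMobius 1 f) {d : ℝ} (hd : 1 ≤ d) :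
    IsMobius (-1) (mapC f d) := by
  have := ((h.comp_one_div_add (e := 1) le_rfl).comp_one_div_add (e := 3)
    (by norm_num)).comp_one_div_add hd
  rw [neg_neg] at this
  exact this

lemma argB_mem {d a b t : ℝ} (hd : 1 ≤ d) (ha : 0 ≤ a) (hb : 0 ≤ b) (ht : t ∈ Icc a b) :
    1 / (1 + 1 / (4 + 1 / (1 + 1 / (d + t)))) ∈
      Icc (1 / (1 + 1 / (4 + 1 / (1 + 1 / (d + a))))) (1 / (1 + 1 / (4 + 1 / (1 + 1 / (d + b))))) :=
  one_div_add_mem_Icc le_rfl (by positivity) <|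
    one_div_add_mem_Icc (by norm_num) (by positivity) <|
      one_div_add_mem_Icc le_rfl (by positivity) <| one_div_add_mem_Icc hd ha ht

lemma argC_mem {d a b t : ℝ} (hd : 1 ≤ d) (ha : 0 ≤ a) (hb : 0 ≤ b) (ht : t ∈ Icc a b) :
    1 / (1 + 1 / (3 + 1 / (d + t))) ∈
      Icc (1 / (1 + 1 / (3 + 1 / (d + b)))) (1 / (1 + 1 / (3 + 1 / (d + a)))) :=
  one_div_add_mem_Icc le_rfl (by positivity) <|
    one_div_add_mem_Icc (by norm_num) (by positivity) <| one_div_add_mem_Icc hd ha ht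

lemma IsLastDigit.gap_mapB_le {m : ℕ} {S : Set ℕ} {lo : ℝ} (h : IsLastDigit m S lo)
    {f : ℝ → ℝ} (hf : IsMobius 1 f) {d : ℝ} (hd : d = 1 ∨ d = 2) :
    |mapB f d (1 / (1 + valMax)) - mapB f d (1 / (2 + valMid))| ≤
      1 * |mapC f m lo - mapC f m valMax| := by
  have hα := valMax_mem
  have hβ := valMid_mem
  have hγ := valMin_mem
  have h1α := one_div_add_mem_Icc (e := 1) (by norm_num) (by norm_num) hα
  have h2β := one_div_add_mem_Icc (e := 2) (by norm_num) (by norm_num) hβ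
  unfold mapB mapC
  cases h <;> rcases hd with rfl | rfl <;> push_cast
  iterate 2
    refine hf.abs_sub_le zero_le_one (argB_mem ?_ ?_ ?_ h2β) (argB_mem ?_ ?_ ?_ h1α)
      (argC_mem ?_ ?_ ?_ hα) (argC_mem ?_ ?_ ?_ hβ) ?_ <;> norm_num
  all_goals
    refine hf.abs_sub_le zero_le_one (argB_mem ?_ ?_ ?_ h2β) (argB_mem ?_ ?_ ?_ h1α)
      (argC_mem ?_ ?_ ?_ hα) (argC_mem ?_ ?_ ?_ hγ) ?_ <;> norm_num

lemma IsLastDigit.gap_mapC_le {m : ℕ} {S : Set ℕ} {lo : ℝ} (h : IsLastDigit m S lo)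
    {f : ℝ → ℝ} (hf : IsMobius 1 f) {d : ℝ} (hd : d = 1 ∨ d = 2) :
    |mapC f m (1 / (2 + valMid)) - mapC f m (1 / (1 + valMax))| ≤
      1 * |mapB f d valMax - mapB f d valMid| := by
  have hα := valMax_mem
  have hβ := valMid_mem
  have h1α := one_div_add_mem_Icc (e := 1) (by norm_num) (by norm_num) hα
  have h2β := one_div_add_mem_Icc (e := 2) (by norm_num) (by norm_num) hβ
  unfold mapB mapC
  cases h <;> rcases hd with rfl | rfl <;> push_cast
  all_goals
    refine hf.abs_sub_le zero_le_one (argC_mem ?_ ?_ ?_ h1α) (argC_mem ?_ ?_ ?_ h2β)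
      (argB_mem ?_ ?_ ?_ hβ) (argB_mem ?_ ?_ ?_ hα) ?_ <;> norm_num

lemma IsLastDigit.overlap {m : ℕ} {S : Set ℕ} {lo : ℝ} (h : IsLastDigit m S lo) {f : ℝ → ℝ}
    (hf : IsMobius 1 f) :
    |mapB f 2 valMid - mapB f 1 valMax| ≤ 0.999 * |mapC f m lo - mapC f m valMax| := by
  have hα := valMax_mem
  have hβ := valMid_mem
  have hγ := valMin_mem
  unfold mapB mapC
  cases h <;> push_cast
  · refine hf.abs_sub_le (by norm_num) (argB_mem ?_ ?_ ?_ hα) (argB_mem ?_ ?_ ?_ hβ)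
      (argC_mem ?_ ?_ ?_ hα) (argC_mem ?_ ?_ ?_ hβ) ?_ <;> norm_num
  all_goals
    refine hf.abs_sub_le (by norm_num) (argB_mem ?_ ?_ ?_ hα) (argB_mem ?_ ?_ ?_ hβ)
      (argC_mem ?_ ?_ ?_ hα) (argC_mem ?_ ?_ ?_ hγ) ?_ <;> norm_num

lemma mapB_one_lt_mapB_two {f : ℝ → ℝ} (hf : IsMobius 1 f) :
    mapB f 1 valMax < mapB f 2 valMid := by
  have h1 := argB_mem (d := 1) le_rfl (by norm_num) (by norm_num) valMax_mem
  have h2 := argB_mem (d := 2) (by norm_num) (by norm_num) (by norm_num) valMid_mem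
  exact hf.lt one_pos (le_trans (by norm_num) h1.1)
    (h1.2.trans_lt (lt_of_lt_of_le (by norm_num) h2.1))
    (h2.2.trans (by norm_num))

lemma bW_succ (k : ℕ) : bW (k + 1) = bW k ++ [1, 4] := by
  simp [bW, List.replicate_succ']

lemma bW_digits {k a : ℕ} (ha : a ∈ bW k) : 1 ≤ a ∧ a ≤ 4 := by
  have : a = 1 ∨ a = 4 := by
    simp only [bW, List.mem_flatten, List.mem_replicate] at ha
    obtain ⟨l, ⟨-, rfl⟩, hl⟩ := ha
    simpa using hl
  omega

lemma isMobius_wordMap_bW (k : ℕ) : IsMobius 1 (wordMap (bW k)) := by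
  have h := isMobius_wordMap fun a ha => (bW_digits (k := k) ha).1
  have h2 : Even (bW k).length := by simp [bW]
  rwa [h2.neg_one_pow] at h

lemma wordMap_bW_append (k d : ℕ) (t : ℝ) :
    wordMap (bW (k + 1) ++ [1, d]) t = mapB (wordMap (bW k)) d t := by
  rw [bW_succ, wordMap_append, wordMap_append]
  simp [wordMap, mapB]

lemma wordMap_cW_append (k m : ℕ) (t : ℝ) :
    wordMap (cW (k + 1) ++ [m]) t = mapC (wordMap (bW k)) m t := by
  rw [cW, Nat.add_sub_cancel, wordMap_append, wordMap_append]
  simp [wordMap, mapC]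

lemma bW_append_digits {k d : ℕ} (hd : 1 ≤ d ∧ d ≤ 4) :
    ∀ a ∈ bW k ++ [1, d], 1 ≤ a ∧ a ≤ 4 := by
  intro a ha
  simp only [List.mem_append, List.mem_cons, List.not_mem_nil, or_false] at ha
  rcases ha with ha | rfl | rfl
  exacts [bW_digits ha, by norm_num, hd]

lemma Kb_bW_append {k d : ℕ} (hd : d = 1 ∨ d = 2) :
    Kb (bW (k + 1) ++ [1, d]) = mapB (wordMap (bW k)) d '' tailSet {1, 2, 3} := by
  have h : bW (k + 1) ++ [1, d] = (bW (k + 1) ++ [1]) ++ [d] := by simp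
  have h1 : ∀ a ∈ bW (k + 1) ++ [1], 1 ≤ a ∧ a ≤ 4 := fun a ha =>
    bW_append_digits (k := k + 1) (d := 1) (by norm_num) a (by simpa using ha)
  rw [h, Kb_append_singleton (S := {1, 2, 3}) h1 (by omega), ← h,
    funext (wordMap_bW_append k d)]
  rcases hd with rfl | rfl <;> simp [badPairs]

lemma IsLastDigit.Kb_cW_append {m : ℕ} {S : Set ℕ} {lo : ℝ} (h : IsLastDigit m S lo) (k : ℕ) :
    Kb (cW (k + 1) ++ [m]) = mapC (wordMap (bW k)) m '' tailSet S := by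
  rw [Kb_append_singleton (w := cW (k + 1)) (S := S) (bW_append_digits (by norm_num))
    (by cases h <;> norm_num), funext (wordMap_cW_append k m)]
  cases h <;> simp [badPairs]

lemma cfVal_bW_append {k d : ℕ} (hd : 1 ≤ d ∧ d ≤ 4) {θ : ℕ → ℕ} (hθ : θ ∈ Dset) :
    cfVal (app (bW (k + 1) ++ [1, d]) θ) = mapB (wordMap (bW k)) d (cfVal θ) := by
  rw [cfVal_app (bW_append_digits hd) (Dset_subset_DigitSeq hθ), wordMap_bW_append]

lemma cW_append_digits {k : ℕ} {w : List ℕ} (hw : ∀ a ∈ w, 1 ≤ a ∧ a ≤ 4) :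
    ∀ a ∈ cW k ++ w, 1 ≤ a ∧ a ≤ 4 := by
  intro a ha
  rcases List.mem_append.1 ha with ha | ha
  exacts [bW_append_digits (by norm_num) a ha, hw a ha]

lemma cfVal_cW_append {k m : ℕ} (hm : 1 ≤ m ∧ m ≤ 4) {θ : ℕ → ℕ} (hθ : θ ∈ Dset) :
    cfVal (app (cW (k + 1) ++ [m]) θ) = mapC (wordMap (bW k)) m (cfVal θ) := by
  rw [cfVal_app (cW_append_digits (by simpa using hm)) (Dset_subset_DigitSeq hθ),
    wordMap_cW_append]

lemma cfVal_cW_append_four {k m : ℕ} (hm : 1 ≤ m ∧ m ≤ 4) :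
    cfVal (app (cW (k + 1) ++ [m, 4]) per13) = mapC (wordMap (bW k)) m valMin := by
  have h : cW (k + 1) ++ [m, 4] = (cW (k + 1) ++ [m]) ++ [4] := by simp
  rw [cfVal_app (cW_append_digits (by simpa using hm)) (Dset_subset_DigitSeq per13_mem_Dset),
    h, wordMap_append, wordMap_cW_append]
  simp [wordMap, valMin, valMax]

lemma IsLastDigit.sum_eq {m : ℕ} {S : Set ℕ} {lo : ℝ} (h : IsLastDigit m S lo) {f : ℝ → ℝ}
    (hf : IsMobius 1 f) {K₁ K₂ K : Set ℝ} (hK₁ : K₁ = mapB f 1 '' tailSet {1, 2, 3})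
    (hK₂ : K₂ = mapB f 2 '' tailSet {1, 2, 3}) (hK : K = mapC f m '' tailSet S) :
    sInf K₂ + sInf K < sSup K₁ + sSup K ∧
      (K₁ ∪ K₂) + K =
        Icc (mapB f 1 valMid + mapC f m valMax) (mapB f 2 valMax + mapC f m lo) := by
  have hm : (1 : ℝ) ≤ m := by cases h <;> norm_num
  have hU₁ := isMobius_mapB hf (d := 1) le_rfl
  have hU₂ := isMobius_mapB hf (d := 2) (by norm_num)
  have hV := isMobius_mapC hf hm
  obtain ⟨l₀, g₀⟩ := isLeast_isGreatest_tailSet_one_to_three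
  obtain ⟨l₁, g₁⟩ := h.isLeast_isGreatest
  have mono₁ := (hU₁.strictMonoOn one_pos).monotoneOn.mono (tailSet_subset_Icc {1, 2, 3})
  have mono₂ := (hU₂.strictMonoOn one_pos).monotoneOn.mono (tailSet_subset_Icc {1, 2, 3})
  have anti := (hV.strictAntiOn (by norm_num)).antitoneOn.mono (tailSet_subset_Icc S)
  have L₁ := mono₁.map_isLeast l₀
  have G₁ := mono₁.map_isGreatest g₀
  have L₂ := mono₂.map_isLeast l₀
  have G₂ := mono₂.map_isGreatest g₀
  have L := anti.map_isGreatest g₁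
  have G := anti.map_isLeast l₁
  rw [← hK₁] at L₁ G₁
  rw [← hK₂] at L₂ G₂
  rw [← hK] at L G
  obtain ⟨o1, o2, o3, o4, o5⟩ := h.isBlock.order
  obtain ⟨p1, p2, p3, p4, p5⟩ := IsBlock.one_to_three.order
  have u1 := hU₁.lt one_pos p1 (p2.trans (p3.trans p4)) p5
  have u2 := hU₂.lt one_pos p1 (p2.trans (p3.trans p4)) p5
  have v := hV.gt (by norm_num) o1 (o2.trans (o3.trans o4)) o5
  have hu := mapB_one_lt_mapB_two hf
  have hov := h.overlap hf
  have a1 := h.gap_mapB_le hf (Or.inl rfl)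
  have a2 := h.gap_mapB_le hf (Or.inr rfl)
  have b1 := h.gap_mapC_le hf (Or.inl rfl)
  have b2 := h.gap_mapC_le hf (Or.inr rfl)
  rw [one_mul] at a1 a2 b1 b2
  rw [abs_of_pos (sub_pos.2 v)] at hov a1 a2
  rw [abs_of_pos (sub_pos.2 hu)] at hov
  rw [abs_sub_comm, abs_of_pos (sub_pos.2 u1)] at b1
  rw [abs_sub_comm, abs_of_pos (sub_pos.2 u2)] at b2
  have P := (h.isBlock.isPiece (by norm_num) hV).symm
  have s1 := (IsBlock.one_to_three.isPiece one_ne_zero hU₁).add_eq_Icc P u1 v a1 b1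
    (fun x hx => ⟨L₁.2 (hK₁ ▸ hx), G₁.2 (hK₁ ▸ hx)⟩) fun x hx => ⟨L.2 (hK ▸ hx), G.2 (hK ▸ hx)⟩
  have s2 := (IsBlock.one_to_three.isPiece one_ne_zero hU₂).add_eq_Icc P u2 v a2 b2
    (fun x hx => ⟨L₂.2 (hK₂ ▸ hx), G₂.2 (hK₂ ▸ hx)⟩) fun x hx => ⟨L.2 (hK ▸ hx), G.2 (hK ▸ hx)⟩
  constructor
  · rw [L₂.csInf_eq, L.csInf_eq, G₁.csSup_eq, G.csSup_eq]
    linarith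
  · rw [union_add, hK₁, hK₂, hK, s1, s2,
      Icc_union_Icc' (by linarith) (by linarith), min_eq_left (by linarith),
      max_eq_right (by linarith)]

/-- For every `s ≥ 1` and `m ∈ {2,3,4}`:
`max K(b^s,1,1) + max K(c^s,m) > min K(b^s,1,2) + min K(c^s,m)`, and consequently
`(K(b^s,1,1) ∪ K(b^s,1,2)) + K(c^s,m)` is the closed interval
`[[0; b^s,1,1,\overline{3,1}] + [0; c^s,m,\overline{1,3}],
  [0; b^s,1,2,\overline{1,3}] + [0; c^s,m,θ^m]]`, where `θ^m = 4,\overline{1,3}`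
if `m ∈ {3,4}` and `θ^m = \overline{3,1}` if `m = 2`. -/
theorem sum_Kbs1p_Kcsm (s : ℕ) (hs : 1 ≤ s) (m : ℕ) (hm : m ∈ ({2, 3, 4} : Set ℕ)) :
    sSup (Kb (bW s ++ [1, 1])) + sSup (Kb (cW s ++ [m])) >
      sInf (Kb (bW s ++ [1, 2])) + sInf (Kb (cW s ++ [m])) ∧
    (Kb (bW s ++ [1, 1]) ∪ Kb (bW s ++ [1, 2])) + Kb (cW s ++ [m]) =
      Set.Icc
        (cfVal (app (bW s ++ [1, 1]) per31) + cfVal (app (cW s ++ [m]) per13))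
        (cfVal (app (bW s ++ [1, 2]) per13) +
          if m = 2 then cfVal (app (cW s ++ [m]) per31)
          else cfVal (app (cW s ++ [m, 4]) per13)) := by
  obtain ⟨k, rfl⟩ : ∃ k, s = k + 1 := ⟨s - 1, by omega⟩
  have hm4 : 1 ≤ m ∧ m ≤ 4 := by
    simp only [mem_insert_iff, mem_singleton_iff] at hm
    omega
  obtain ⟨S, lo, h, hlo⟩ : ∃ S lo, IsLastDigit m S lo ∧
      mapC (wordMap (bW k)) m lo = if m = 2 then cfVal (app (cW (k + 1) ++ [m]) per31)
        else cfVal (app (cW (k + 1) ++ [m, 4]) per13) := by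
    rw [cfVal_cW_append hm4 per31_mem_Dset, cfVal_cW_append_four hm4]
    simp only [mem_insert_iff, mem_singleton_iff] at hm
    rcases hm with rfl | rfl | rfl
    exacts [⟨_, _, .two, by simp [valMid]⟩, ⟨_, _, .three, by simp⟩, ⟨_, _, .four, by simp⟩]
  rw [← hlo, cfVal_bW_append (by norm_num) per31_mem_Dset,
    cfVal_bW_append (by norm_num) per13_mem_Dset, cfVal_cW_append hm4 per13_mem_Dset]
  have := h.sum_eq (isMobius_wordMap_bW k) (by simpa using Kb_bW_append (k := k) (Or.inl rfl))
    (by simpa using Kb_bW_append (k := k) (Or.inr rfl)) (h.Kb_cW_append k)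
  simpa [valMax, valMid] using this
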